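/- arXiv:0806.1587 — 3 statements merged into one kernel-verified Lean document; each statement's English description precedes it below -/
import Mathlib

section
/- For every opinion distribution p, the Lyapunov function L satisfies the identity L(pB^DW(p,ε)) − L(p) = Σ_{1 ≤ i < j ≤ n, 2 ≤ j−i ≤ ε} (2^{⌊(i+j)/2⌋} + 2^{⌈(i+j)/2⌉} − 2^i − 2^j) · p i · p j. -/
open Finset
open scoped Classical

/-- `p : ℤ → ℝ` is an opinion distribution on the classes `{1,…,n}`:
nonnegative, vanishing outside `{1,…,n}`, summing to `1`. -/
def IsDist (n : ℤ) (p : ℤ → ℝ) : Prop :=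
  (∀ m, 0 ≤ p m) ∧ (∀ m, m ∉ Finset.Icc (1:ℤ) n → p m = 0) ∧
    (∑ k ∈ Finset.Icc (1:ℤ) n, p k) = 1

/-- `π^i m = p m` if `|i - m| ≤ ε`, else `0`. -/
noncomputable def piF (p : ℤ → ℝ) (ε i m : ℤ) : ℝ :=
  if |i - m| ≤ ε then p m else 0

/-- Off-diagonal entry of the Deffuant–Weisbuch transition matrix. -/
noncomputable def BDWoff (p : ℤ → ℝ) (ε i j : ℤ) : ℝ :=
  piF p ε i (2*j - i - 1) / 2 + piF p ε i (2*j - i) + piF p ε i (2*j - i + 1) / 2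

/-- The Deffuant–Weisbuch transition matrix `B^DW(p,ε)` on `{1,…,n} × {1,…,n}`. -/
noncomputable def BDW (n : ℤ) (p : ℤ → ℝ) (ε i j : ℤ) : ℝ :=
  if i = j then 1 - ∑ j' ∈ (Finset.Icc (1:ℤ) n).erase i, BDWoff p ε i j'
  else BDWoff p ε i j

/-- One step of the DW interactive Markov chain: `(pB^DW(p,ε)) k`. -/
noncomputable def stepDW (n : ℤ) (p : ℤ → ℝ) (ε : ℤ) (k : ℤ) : ℝ :=
  ∑ i ∈ Finset.Icc (1:ℤ) n, p i * BDW n p ε i k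

/-- The Lyapunov function `L(p) = ∑_{i=1}^n 2^i p i`. -/
noncomputable def Lyap (n : ℤ) (p : ℤ → ℝ) : ℝ :=
  ∑ i ∈ Finset.Icc (1:ℤ) n, (2:ℝ)^i * p i

noncomputable def wDW (i m j : ℤ) : ℝ :=
  (if j = (i + m) / 2 then 1 / 2 else 0) + (if j = (i + m + 1) / 2 then 1 / 2 else 0)

lemma wDW_eq (i m j : ℤ) : wDW i m j =
    (if m = 2*j - i - 1 then 1/2 else 0) + (if m = 2*j - i then 1 else 0)
      + (if m = 2*j - i + 1 then 1/2 else 0) := by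
  unfold wDW
  rcases lt_trichotomy m (2*j-i) with h | h | h
  · by_cases h2 : m = 2*j-i-1
    · rw [if_neg (by omega), if_pos (by omega), if_pos (by omega), if_neg (by omega),
        if_neg (by omega)]; norm_num
    · rw [if_neg (by omega), if_neg (by omega), if_neg (by omega), if_neg (by omega),
        if_neg (by omega)]; norm_num
  · rw [if_pos (by omega), if_pos (by omega), if_neg (by omega), if_pos (by omega),
        if_neg (by omega)]; norm_num
  · by_cases h2 : m = 2*j-i+1
    · rw [if_pos (by omega), if_neg (by omega), if_neg (by omega), if_neg (by omega),
        if_pos (by omega)]; norm_num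
    · rw [if_neg (by omega), if_neg (by omega), if_neg (by omega), if_neg (by omega),
        if_neg (by omega)]; norm_num

lemma sum_piF_ite (n : ℤ) (p : ℤ → ℝ) (ε i a : ℤ) (c : ℝ)
    (hp : ∀ m, m ∉ Finset.Icc (1:ℤ) n → p m = 0) :
    ∑ m ∈ Finset.Icc (1:ℤ) n, piF p ε i m * (if m = a then c else 0) = piF p ε i a * c := by
  simp only [mul_ite, mul_zero]
  rw [Finset.sum_ite_eq']
  split_ifs with h
  · rfl
  · simp [piF, hp a h]

lemma BDWoff_eq (n : ℤ) (p : ℤ → ℝ) (ε i j : ℤ)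
    (hp : ∀ m, m ∉ Finset.Icc (1:ℤ) n → p m = 0) :
    BDWoff p ε i j = ∑ m ∈ Finset.Icc (1:ℤ) n, piF p ε i m * wDW i m j := by
  simp only [wDW_eq, mul_add, Finset.sum_add_distrib, sum_piF_ite n p ε i _ _ hp]
  unfold BDWoff
  ring

lemma sum_wDW (n i m : ℤ) (f : ℤ → ℝ) (hi : i ∈ Finset.Icc (1:ℤ) n)
    (hm : m ∈ Finset.Icc (1:ℤ) n) :
    ∑ j ∈ Finset.Icc (1:ℤ) n, wDW i m j * f j = (f ((i+m)/2) + f ((i+m+1)/2)) / 2 := by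
  rw [Finset.mem_Icc] at hi hm
  simp only [wDW, add_mul, Finset.sum_add_distrib, ite_mul, zero_mul]
  rw [Finset.sum_ite_eq', Finset.sum_ite_eq', if_pos (Finset.mem_Icc.2 (by omega)),
    if_pos (Finset.mem_Icc.2 (by omega))]
  ring

lemma row_sum (n : ℤ) (p : ℤ → ℝ) (ε i : ℤ) (f : ℤ → ℝ) (hi : i ∈ Finset.Icc (1:ℤ) n) :
    ∑ j ∈ Finset.Icc (1:ℤ) n, BDW n p ε i j * f j - f i
      = ∑ j ∈ Finset.Icc (1:ℤ) n, BDWoff p ε i j * (f j - f i) := by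
  rw [← Finset.add_sum_erase _ _ hi, ← Finset.add_sum_erase _ (fun j => BDWoff p ε i j * _) hi]
  have h : ∑ j ∈ (Finset.Icc (1:ℤ) n).erase i, BDW n p ε i j * f j
      = ∑ j ∈ (Finset.Icc (1:ℤ) n).erase i, BDWoff p ε i j * f j := by
    refine Finset.sum_congr rfl fun j hj => ?_
    rw [BDW, if_neg (Finset.ne_of_mem_erase hj).symm]
  rw [h, BDW, if_pos rfl]
  simp only [mul_sub, Finset.sum_sub_distrib, ← Finset.sum_mul]
  ring

lemma row_sum2 (n : ℤ) (p : ℤ → ℝ) (ε i : ℤ) (f : ℤ → ℝ) (hi : i ∈ Finset.Icc (1:ℤ) n)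
    (hp : ∀ m, m ∉ Finset.Icc (1:ℤ) n → p m = 0) :
    ∑ j ∈ Finset.Icc (1:ℤ) n, BDW n p ε i j * f j - f i
      = ∑ m ∈ Finset.Icc (1:ℤ) n, piF p ε i m * ((f ((i+m)/2) + f ((i+m+1)/2)) / 2 - f i) := by
  rw [row_sum n p ε i f hi]
  simp only [BDWoff_eq n p ε i _ hp, Finset.sum_mul]
  rw [Finset.sum_comm]
  refine Finset.sum_congr rfl fun m hm => ?_
  simp only [mul_assoc]
  rw [← Finset.mul_sum, sum_wDW n i m (fun j => f j - f i) hi hm]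
  ring

lemma floor_half (a b : ℤ) : ⌊((a:ℝ) + (b:ℝ))/2⌋ = (a + b) / 2 := by
  rw [Int.floor_eq_iff]
  have h1 : ((a+b)/2) * 2 ≤ a + b := by omega
  have h2 : a + b < ((a+b)/2) * 2 + 2 := by omega
  have h1' : (((a+b)/2 : ℤ) : ℝ) * 2 ≤ a + b := by exact_mod_cast h1
  have h2' : (a:ℝ) + b < (((a+b)/2 : ℤ) : ℝ) * 2 + 2 := by exact_mod_cast h2
  constructor <;> linarith

lemma ceil_half (a b : ℤ) : ⌈((a:ℝ) + (b:ℝ))/2⌉ = (a + b + 1) / 2 := by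
  rw [Int.ceil_eq_iff]
  have h1 : ((a+b+1)/2) * 2 < a + b + 2 := by omega
  have h2 : a + b ≤ ((a+b+1)/2) * 2 := by omega
  have h1' : (((a+b+1)/2 : ℤ) : ℝ) * 2 < a + b + 2 := by exact_mod_cast h1
  have h2' : (a:ℝ) + b ≤ (((a+b+1)/2 : ℤ) : ℝ) * 2 := by exact_mod_cast h2
  constructor <;> linarith

lemma pair_eq (p : ℤ → ℝ) (ε : ℤ) (f : ℤ → ℝ) (i m : ℤ) :
    p i * (piF p ε i m * ((f ((i+m)/2) + f ((i+m+1)/2)) / 2 - f i))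
      + p m * (piF p ε m i * ((f ((m+i)/2) + f ((m+i+1)/2)) / 2 - f m))
    = (if i < m ∧ 2 ≤ m - i ∧ m - i ≤ ε then
        (f ((i+m)/2) + f ((i+m+1)/2) - f i - f m) * p i * p m else 0)
      + (if m < i ∧ 2 ≤ i - m ∧ i - m ≤ ε then
        (f ((m+i)/2) + f ((m+i+1)/2) - f m - f i) * p m * p i else 0) := by
  rw [add_comm m i]
  unfold piF
  rw [abs_sub_comm m i]
  by_cases he : |i - m| ≤ ε
  · rw [if_pos he, if_pos he]
    rw [abs_le] at he
    by_cases h1 : 2 ≤ m - i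
    · rw [if_pos (by omega), if_neg (by omega)]; ring
    by_cases h2 : 2 ≤ i - m
    · rw [if_neg (by omega), if_pos (by omega)]; ring
    rw [if_neg (by omega), if_neg (by omega)]
    rcases lt_trichotomy i m with h | h | h
    · rw [show (i+m)/2 = i by omega, show (i+m+1)/2 = m by omega]; ring
    · rw [show (i+m)/2 = i by omega, show (i+m+1)/2 = i by omega, h]; ring
    · rw [show (i+m)/2 = m by omega, show (i+m+1)/2 = i by omega]; ring
  · rw [if_neg he, if_neg he]
    rw [abs_le] at he
    rw [if_neg (by omega), if_neg (by omega)]; ring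

/-- the change of the Lyapunov function `L(p) = ∑ 2^i p i` along one
DW step equals a sum over interacting pairs `i < j`. -/
theorem dw_chain_lyapunov_identity (n ε : ℤ) (hn : 1 ≤ n) (hε : 1 ≤ ε)
    (p : ℤ → ℝ) (hp : IsDist n p) :
    Lyap n (stepDW n p ε) - Lyap n p =
      ∑ ij ∈ ((Finset.Icc (1:ℤ) n) ×ˢ (Finset.Icc (1:ℤ) n)).filter
          (fun ij => ij.1 < ij.2 ∧ 2 ≤ ij.2 - ij.1 ∧ ij.2 - ij.1 ≤ ε),
        ((2:ℝ)^(⌊((ij.1:ℝ) + (ij.2:ℝ))/2⌋) + (2:ℝ)^(⌈((ij.1:ℝ) + (ij.2:ℝ))/2⌉)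
          - (2:ℝ)^(ij.1) - (2:ℝ)^(ij.2)) * p ij.1 * p ij.2 := by
  obtain ⟨-, hp, -⟩ := hp
  simp only [floor_half, ceil_half]
  rw [Finset.sum_filter, Finset.sum_product]
  have hL : Lyap n (stepDW n p ε) - Lyap n p = ∑ i ∈ Finset.Icc (1:ℤ) n,
      ∑ m ∈ Finset.Icc (1:ℤ) n, p i * (piF p ε i m *
        (((2:ℝ) ^ ((i+m)/2) + (2:ℝ) ^ ((i+m+1)/2)) / 2 - (2:ℝ) ^ i)) := by
    unfold Lyap stepDW
    simp only [Finset.mul_sum]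
    rw [Finset.sum_comm, ← Finset.sum_sub_distrib]
    refine Finset.sum_congr rfl fun i hi => ?_
    rw [← Finset.mul_sum, ← row_sum2 n p ε i (fun j => (2:ℝ) ^ j) hi hp, mul_sub, Finset.mul_sum,
      mul_comm (p i) (2 ^ i)]
    congr 1
    exact Finset.sum_congr rfl fun j _ => by ring
  rw [hL]
  have key : ∀ G R : ℤ → ℤ → ℝ, (∀ i m, G i m + G m i = R i m + R m i) →
      ∑ i ∈ Finset.Icc (1:ℤ) n, ∑ m ∈ Finset.Icc (1:ℤ) n, G i m
        = ∑ i ∈ Finset.Icc (1:ℤ) n, ∑ m ∈ Finset.Icc (1:ℤ) n, R i m := by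
    intro G R h
    have h1 : ∑ i ∈ Finset.Icc (1:ℤ) n, ∑ m ∈ Finset.Icc (1:ℤ) n, (G i m + G m i)
        = ∑ i ∈ Finset.Icc (1:ℤ) n, ∑ m ∈ Finset.Icc (1:ℤ) n, (R i m + R m i) := by
      simp only [h]
    simp only [Finset.sum_add_distrib] at h1
    rw [Finset.sum_comm (f := fun i m => G m i), Finset.sum_comm (f := fun i m => R m i)] at h1
    linarith
  exact key _ _ fun i m => pair_eq p ε (fun j => (2:ℝ) ^ j) i m
end

section
/- Let p be a fixed point of the HK interactive Markov chain and let i ∈ {1,…,n} with p i > 0 and M_i < i. Then i > 1, p (i−1) > 0, and i − 1 < M_{i−1} ≤ M_i < i. -/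
open Finset
open scoped Classical

/-- The barycenter `M^bary_{[a..b]}(p)`: the mean class of `p` on `[a..b]`,
and the midpoint `(a+b)/2` if `p` has no mass there. -/
noncomputable def Mbary (p : ℤ → ℝ) (a b : ℤ) : ℝ :=
  if (∑ k ∈ Finset.Icc a b, p k) ≠ 0 then
    (∑ k ∈ Finset.Icc a b, (k:ℝ) * p k) / (∑ k ∈ Finset.Icc a b, p k)
  else ((a:ℝ) + (b:ℝ)) / 2

/-- The `ε`-local mean `M_i = M^bary_{[i-ε..i+ε]}(p)`. -/
noncomputable def locM (p : ℤ → ℝ) (ε i : ℤ) : ℝ := Mbary p (i - ε) (i + ε)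

/-- The Hegselmann–Krause transition matrix `B^HK(p,ε)` on `{1,…,n} × {1,…,n}`. -/
noncomputable def BHK (p : ℤ → ℝ) (ε i j : ℤ) : ℝ :=
  if (j:ℝ) = locM p ε i then 1
  else if j = ⌊locM p ε i⌋ then (⌈locM p ε i⌉ : ℝ) - locM p ε i
  else if j = ⌈locM p ε i⌉ then locM p ε i - (⌊locM p ε i⌋ : ℝ)
  else 0

/-- One step of the HK interactive Markov chain: `(pB^HK(p,ε)) k`. -/
noncomputable def stepHK (n : ℤ) (p : ℤ → ℝ) (ε : ℤ) (k : ℤ) : ℝ :=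
  ∑ i ∈ Finset.Icc (1:ℤ) n, p i * BHK p ε i k

lemma hk_locM_step (p : ℤ → ℝ) (h0 : ∀ m, 0 ≤ p m) (ε : ℤ) (hε : 1 ≤ ε) (j : ℤ) :
    locM p ε j ≤ locM p ε (j + 1) := by
  have hA : Finset.Icc (j - ε) (j + ε) = insert (j - ε) (Finset.Icc (j + 1 - ε) (j + ε)) := by
    ext x; simp only [Finset.mem_Icc, Finset.mem_insert]; omega
  have hB : Finset.Icc (j + 1 - ε) (j + 1 + ε)
      = insert (j + 1 + ε) (Finset.Icc (j + 1 - ε) (j + ε)) := by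
    ext x; simp only [Finset.mem_Icc, Finset.mem_insert]; omega
  have hnA : (j - ε) ∉ Finset.Icc (j + 1 - ε) (j + ε) := by
    simp only [Finset.mem_Icc]; omega
  have hnB : (j + 1 + ε) ∉ Finset.Icc (j + 1 - ε) (j + ε) := by
    simp only [Finset.mem_Icc]; omega
  unfold locM Mbary
  rw [hA, hB, Finset.sum_insert hnA, Finset.sum_insert hnA, Finset.sum_insert hnB,
    Finset.sum_insert hnB]
  have hm : 0 ≤ ∑ k ∈ Finset.Icc (j + 1 - ε) (j + ε), p k := Finset.sum_nonneg fun k _ => h0 k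
  have hlo : ((j:ℝ) + 1 - ε) * ∑ k ∈ Finset.Icc (j + 1 - ε) (j + ε), p k
      ≤ ∑ k ∈ Finset.Icc (j + 1 - ε) (j + ε), (k:ℝ) * p k := by
    rw [Finset.mul_sum]
    refine Finset.sum_le_sum fun k hk => mul_le_mul_of_nonneg_right ?_ (h0 k)
    exact_mod_cast (Finset.mem_Icc.1 hk).1
  have hhi : ∑ k ∈ Finset.Icc (j + 1 - ε) (j + ε), (k:ℝ) * p k
      ≤ ((j:ℝ) + ε) * ∑ k ∈ Finset.Icc (j + 1 - ε) (j + ε), p k := by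
    rw [Finset.mul_sum]
    refine Finset.sum_le_sum fun k hk => mul_le_mul_of_nonneg_right ?_ (h0 k)
    exact_mod_cast (Finset.mem_Icc.1 hk).2
  generalize (∑ k ∈ Finset.Icc (j + 1 - ε) (j + ε), p k) = m at *
  generalize (∑ k ∈ Finset.Icc (j + 1 - ε) (j + ε), (k:ℝ) * p k) = f at *
  have ha := h0 (j - ε)
  have hb := h0 (j + 1 + ε)
  generalize p (j - ε) = a at *
  generalize p (j + 1 + ε) = b at *
  have he : (1:ℝ) ≤ ε := by exact_mod_cast hε
  push_cast
  generalize (ε:ℝ) = e at *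
  generalize (j:ℝ) = x at *
  by_cases h1 : a + m = 0
  · have hm0 : m = 0 := by linarith
    have hf0 : f = 0 := by subst hm0; simp at hlo hhi; linarith
    subst hm0 hf0
    by_cases h2 : b + 0 = 0
    · simp only [h1, h2, ne_eq, not_true_eq_false, if_false]; linarith
    · have h2' : b ≠ 0 := by simpa using h2
      simp only [h1, h2', ne_eq, not_true_eq_false, not_false_eq_true, if_false, if_true, add_zero]
      rw [mul_div_cancel_right₀ _ h2']; linarith
  · by_cases h2 : b + m = 0
    · have hm0 : m = 0 := by linarith
      have hf0 : f = 0 := by subst hm0; simp at hlo hhi; linarith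
      subst hm0 hf0
      have h1' : a ≠ 0 := by simpa using h1
      simp only [h1', h2, ne_eq, not_true_eq_false, not_false_eq_true, if_false, if_true, add_zero]
      rw [mul_div_cancel_right₀ _ h1']; linarith
    · simp only [h1, h2, ne_eq, not_false_eq_true, if_true]
      have p1 : 0 < a + m := lt_of_le_of_ne (by linarith) (Ne.symm h1)
      have p2 : 0 < b + m := lt_of_le_of_ne (by linarith) (Ne.symm h2)
      rw [div_le_div_iff₀ p1 p2]
      have q1 : 0 ≤ a * (f - (x - e) * m) := mul_nonneg ha (by nlinarith)
      have q2 : 0 ≤ b * ((x + 1 + e) * m - f) := mul_nonneg hb (by nlinarith)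
      have q3 : 0 ≤ a * b * (1 + 2 * e) := by positivity
      nlinarith

lemma hk_locM_mono (p : ℤ → ℝ) (h0 : ∀ m, 0 ≤ p m) (ε : ℤ) (hε : 1 ≤ ε) :
    Monotone (locM p ε) :=
  monotone_int_of_le_succ (hk_locM_step p h0 ε hε)

lemma hk_BHK_eq (p : ℤ → ℝ) (ε i j : ℤ) :
    BHK p ε i j = (if j = ⌊locM p ε i⌋ then (⌊locM p ε i⌋:ℝ) + 1 - locM p ε i else 0)
      + (if j = ⌊locM p ε i⌋ + 1 then locM p ε i - (⌊locM p ε i⌋:ℝ) else 0) := by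
  unfold BHK
  generalize locM p ε i = M
  by_cases hM : M = (⌊M⌋:ℝ)
  · have hc : ⌈M⌉ = ⌊M⌋ := by
      conv_lhs => rw [hM]
      exact Int.ceil_intCast _
    have e : ((j:ℝ) = M) ↔ j = ⌊M⌋ := by
      constructor
      · intro h; rw [← h]; simp
      · intro h; rw [h]; exact hM.symm
    rw [hc]
    have hz : M - (⌊M⌋:ℝ) = 0 := by linarith
    simp only [e, hz, ite_self, add_zero]
    by_cases h : j = ⌊M⌋
    · simp only [h, if_true]; linarith
    · simp [h]
  · have hl : (⌊M⌋:ℝ) < M := lt_of_le_of_ne (Int.floor_le M) (Ne.symm hM)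
    have hc : ⌈M⌉ = ⌊M⌋ + 1 := by
      rw [Int.ceil_eq_iff]; push_cast
      exact ⟨by linarith, (Int.lt_floor_add_one M).le⟩
    have e : ¬ ((j:ℝ) = M) := by
      intro h; apply hM; rw [← h]; simp
    rw [hc, if_neg e]
    by_cases h : j = ⌊M⌋
    · simp [h]
    · simp [h]

lemma hk_BHK_nonneg (p : ℤ → ℝ) (ε i j : ℤ) : 0 ≤ BHK p ε i j := by
  rw [hk_BHK_eq]
  have h1 := Int.floor_le (locM p ε i)
  have h2 := Int.lt_floor_add_one (locM p ε i)
  apply add_nonneg <;> split_ifs <;> linarith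

lemma hk_BHK_sum_le (p : ℤ → ℝ) (ε i : ℤ) (s : Finset ℤ) : ∑ k ∈ s, BHK p ε i k ≤ 1 := by
  simp only [hk_BHK_eq, Finset.sum_add_distrib, Finset.sum_ite_eq']
  have h1 := Int.floor_le (locM p ε i)
  have h2 := Int.lt_floor_add_one (locM p ε i)
  split_ifs <;> linarith

lemma hk_BHK_sum_lt (p : ℤ → ℝ) (ε i a b : ℤ) (h : locM p ε i < a) :
    ∑ k ∈ Finset.Icc a b, BHK p ε i k < 1 := by
  simp only [hk_BHK_eq, Finset.sum_add_distrib, Finset.sum_ite_eq']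
  have h1 := Int.floor_le (locM p ε i)
  have h2 := Int.lt_floor_add_one (locM p ε i)
  have h3 : ⌊locM p ε i⌋ ∉ Finset.Icc a b := by
    have := Int.floor_lt.2 h
    simp only [Finset.mem_Icc]; omega
  rw [if_neg h3]
  split_ifs <;> linarith

lemma hk_BHK_zero (p : ℤ → ℝ) (ε i k : ℤ) (h : locM p ε i ≤ (k:ℝ) - 1) :
    BHK p ε i k = 0 := by
  rw [hk_BHK_eq]
  have h1 := Int.floor_le (locM p ε i)
  have h3 : ¬ k = ⌊locM p ε i⌋ := by
    intro hk; rw [← hk] at h1; linarith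
  rw [if_neg h3, zero_add]
  split_ifs with h4
  · rw [h4] at h; push_cast at h; linarith
  · rfl

/-- in a fixed point of the HK interactive Markov chain, if `p i > 0`
and `M_i < i` then `i > 1`, `p (i-1) > 0` and `i-1 < M_{i-1} ≤ M_i < i`. -/
theorem hk_chain_fixed_left_pair (n ε : ℤ) (hn : 1 ≤ n) (hε : 1 ≤ ε)
    (p : ℤ → ℝ) (hp : IsDist n p)
    (hfix : ∀ k ∈ Finset.Icc (1:ℤ) n, stepHK n p ε k = p k)
    (i : ℤ) (hi : i ∈ Finset.Icc (1:ℤ) n) (hpi : 0 < p i)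
    (hMi : locM p ε i < (i:ℝ)) :
    1 < i ∧ 0 < p (i-1) ∧ (i:ℝ) - 1 < locM p ε (i-1) ∧ locM p ε (i-1) ≤ locM p ε i ∧
      locM p ε i < (i:ℝ) := by
  obtain ⟨h0, -, -⟩ := hp
  have hmono := hk_locM_mono p h0 ε hε
  obtain ⟨hi1, hin⟩ := Finset.mem_Icc.1 hi
  have key : ∃ j ∈ Finset.Icc (1:ℤ) n, j < i ∧ 0 < p j ∧ (i:ℝ) - 1 < locM p ε j := by
    by_contra hcon
    push Not at hcon
    have hS : ∑ k ∈ Finset.Icc i n, p k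
        = ∑ j ∈ Finset.Icc (1:ℤ) n, p j * ∑ k ∈ Finset.Icc i n, BHK p ε j k := by
      simp only [Finset.mul_sum]
      rw [Finset.sum_comm]
      refine Finset.sum_congr rfl fun k hk => ?_
      rw [← hfix k (by simp only [Finset.mem_Icc] at hk ⊢; omega)]
      rfl
    have hR : ∑ j ∈ Finset.Icc (1:ℤ) n, p j * ∑ k ∈ Finset.Icc i n, BHK p ε j k
        = ∑ j ∈ Finset.Icc i n, p j * ∑ k ∈ Finset.Icc i n, BHK p ε j k := by
      symm
      apply Finset.sum_subset (Finset.Icc_subset_Icc_left hi1)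
      intro j hj hj'
      have hji : j < i := by simp only [Finset.mem_Icc] at hj hj'; omega
      rcases (h0 j).eq_or_lt with hz | hpos
      · rw [← hz, zero_mul]
      · have hle := hcon j hj hji hpos
        rw [Finset.sum_eq_zero, mul_zero]
        intro k hk
        apply hk_BHK_zero
        have : (i:ℝ) ≤ k := by exact_mod_cast (Finset.mem_Icc.1 hk).1
        linarith
    have hlt : ∑ j ∈ Finset.Icc i n, p j * ∑ k ∈ Finset.Icc i n, BHK p ε j k
        < ∑ k ∈ Finset.Icc i n, p k := by
      apply Finset.sum_lt_sum
      · intro j _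
        exact mul_le_of_le_one_right (h0 j) (hk_BHK_sum_le p ε j _)
      · exact ⟨i, Finset.mem_Icc.2 ⟨le_rfl, hin⟩,
          mul_lt_of_lt_one_right hpi (hk_BHK_sum_lt p ε i i n hMi)⟩
    linarith
  obtain ⟨j, hj, hji, hpj, hMj⟩ := key
  have hj1 := (Finset.mem_Icc.1 hj).1
  have m1 : locM p ε j ≤ locM p ε (i-1) := hmono (by omega)
  have m2 : locM p ε (i-1) ≤ locM p ε i := hmono (by omega)
  refine ⟨by omega, ?_, by linarith, m2, hMi⟩
  rw [← hfix (i-1) (Finset.mem_Icc.2 ⟨by omega, by omega⟩)]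
  unfold stepHK
  refine Finset.sum_pos' (fun k _ => mul_nonneg (h0 k) (hk_BHK_nonneg p ε k _))
    ⟨j, hj, mul_pos hpj ?_⟩
  have hfl : ⌊locM p ε j⌋ = i - 1 := by
    rw [Int.floor_eq_iff]; push_cast
    constructor <;> linarith
  rw [hk_BHK_eq, hfl]
  simp only [if_true]
  rw [if_neg (by omega)]
  push_cast
  linarith
end

section
/- Let p be a fixed point of the HK interactive Markov chain and let i ∈ {1,…,n−1} with p i > 0, p (i+1) > 0 and i < M_i ≤ M_{i+1} < i+1. Then M_i · p i + M_{i+1} · p (i+1) = i · p i + (i+1) · p (i+1). -/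
open Finset
open scoped Classical

lemma BHK_eq (p : ℤ → ℝ) (ε j m : ℤ) :
    BHK p ε j m = (if m = ⌊locM p ε j⌋ then 1 - (locM p ε j - ⌊locM p ε j⌋) else 0)
      + (if m = ⌊locM p ε j⌋ + 1 then locM p ε j - ⌊locM p ε j⌋ else 0) := by
  unfold BHK
  generalize locM p ε j = M
  by_cases hM : (⌊M⌋ : ℝ) = M
  · have hc : ⌈M⌉ = ⌊M⌋ := by
      rw [← hM]; simp
    have h0 : M - ⌊M⌋ = 0 := by linarith
    rw [hc, h0]
    by_cases hm : m = ⌊M⌋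
    · subst hm
      simp [hM]
    · have : (m : ℝ) ≠ M := by
        rw [← hM]; exact_mod_cast hm
      simp [hm, this]
  · have hlt : (⌊M⌋ : ℝ) < M := lt_of_le_of_ne (Int.floor_le M) hM
    have hc : ⌈M⌉ = ⌊M⌋ + 1 := by
      rw [Int.ceil_eq_iff]
      have := Int.lt_floor_add_one M
      push_cast
      constructor <;> linarith
    have hm : (m : ℝ) ≠ M := by
      rintro rfl
      simp at hM
    rw [hc, if_neg hm]
    by_cases h1 : m = ⌊M⌋
    · have h2 : m ≠ ⌊M⌋ + 1 := by omega
      rw [if_pos h1, if_pos h1, if_neg h2]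
      push_cast; ring
    · rw [if_neg h1, if_neg h1]
      simp

/-- The share of class `j` that is sent to `{1,…,k}`. -/
noncomputable def leftShare (p : ℤ → ℝ) (ε k j : ℤ) : ℝ :=
  ∑ m ∈ Finset.Icc (1:ℤ) k, BHK p ε j m

lemma leftShare_eq (p : ℤ → ℝ) (ε k j : ℤ) (h : 1 ≤ locM p ε j) :
    leftShare p ε k j = (if ⌊locM p ε j⌋ ≤ k then 1 - (locM p ε j - ⌊locM p ε j⌋) else 0)
      + (if ⌊locM p ε j⌋ + 1 ≤ k then locM p ε j - ⌊locM p ε j⌋ else 0) := by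
  have h1 : 1 ≤ ⌊locM p ε j⌋ := Int.le_floor.2 (by exact_mod_cast h)
  have h2 : 1 ≤ ⌊locM p ε j⌋ + 1 := by omega
  unfold leftShare
  simp_rw [BHK_eq, Finset.sum_add_distrib]
  rw [Finset.sum_ite_eq', Finset.sum_ite_eq']
  simp only [Finset.mem_Icc, h1, h2, true_and]

lemma leftShare_bounds (p : ℤ → ℝ) (ε k j : ℤ) (h : 1 ≤ locM p ε j) :
    0 ≤ leftShare p ε k j ∧ leftShare p ε k j ≤ 1 := by
  rw [leftShare_eq p ε k j h]
  have a := Int.floor_le (locM p ε j)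
  have b := Int.lt_floor_add_one (locM p ε j)
  split_ifs <;> constructor <;> linarith

lemma leftShare_one (p : ℤ → ℝ) (ε k j : ℤ) (h : 1 ≤ locM p ε j) (hk : locM p ε j ≤ k) :
    leftShare p ε k j = 1 := by
  rw [leftShare_eq p ε k j h]
  have a := Int.floor_le (locM p ε j)
  have c : ⌊locM p ε j⌋ ≤ k := by
    have : (⌊locM p ε j⌋ : ℝ) ≤ k := a.trans hk
    exact_mod_cast this
  rw [if_pos c]
  split_ifs with d
  · ring
  · have e : ⌊locM p ε j⌋ = k := by omega
    rw [e] at a ⊢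
    linarith

lemma leftShare_zero (p : ℤ → ℝ) (ε k j : ℤ) (h : 1 ≤ locM p ε j)
    (hk : (k : ℝ) + 1 ≤ locM p ε j) :
    leftShare p ε k j = 0 := by
  rw [leftShare_eq p ε k j h]
  have c : k + 1 ≤ ⌊locM p ε j⌋ := Int.le_floor.2 (by exact_mod_cast hk)
  rw [if_neg (by omega), if_neg (by omega)]
  simp

lemma leftShare_mid (p : ℤ → ℝ) (ε k j : ℤ) (h : 1 ≤ locM p ε j)
    (hk : (k : ℝ) ≤ locM p ε j) (hk' : locM p ε j < k + 1) :
    leftShare p ε k j = k + 1 - locM p ε j := by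
  rw [leftShare_eq p ε k j h]
  have c : ⌊locM p ε j⌋ = k := Int.floor_eq_iff.2 ⟨hk, hk'⟩
  rw [c, if_pos le_rfl, if_neg (by omega)]
  ring

lemma mass_pos (p : ℤ → ℝ) (ε j : ℤ) (hε : 1 ≤ ε) (h0 : ∀ m, 0 ≤ p m) (hj : 0 < p j) :
    0 < ∑ k ∈ Finset.Icc (j - ε) (j + ε), p k :=
  Finset.sum_pos' (fun m _ => h0 m) ⟨j, by simp; omega, hj⟩

lemma locM_central (p : ℤ → ℝ) (ε j : ℤ) (c : ℝ)
    (hm : 0 < ∑ k ∈ Finset.Icc (j - ε) (j + ε), p k) :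
    ∑ k ∈ Finset.Icc (j - ε) (j + ε), ((k:ℝ) - c) * p k
      = (locM p ε j - c) * ∑ k ∈ Finset.Icc (j - ε) (j + ε), p k := by
  unfold locM Mbary
  rw [if_pos hm.ne', sub_mul, div_mul_cancel₀ _ hm.ne', Finset.mul_sum, ← Finset.sum_sub_distrib]
  exact Finset.sum_congr rfl fun k _ => by ring

lemma le_locM (p : ℤ → ℝ) (ε j : ℤ) (c : ℝ)
    (hm : 0 < ∑ k ∈ Finset.Icc (j - ε) (j + ε), p k)
    (h : 0 ≤ ∑ k ∈ Finset.Icc (j - ε) (j + ε), ((k:ℝ) - c) * p k) : c ≤ locM p ε j := by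
  rw [locM_central p ε j c hm] at h
  have := nonneg_of_mul_nonneg_left h hm
  linarith

lemma locM_le (p : ℤ → ℝ) (ε j : ℤ) (hε : 1 ≤ ε) (h0 : ∀ m, 0 ≤ p m) (hj : 0 < p j) :
    locM p ε j ≤ j + ε := by
  have hm := mass_pos p ε j hε h0 hj
  have h := locM_central p ε j (j + ε) hm
  have h' : ∑ k ∈ Finset.Icc (j - ε) (j + ε), ((k:ℝ) - (j + ε)) * p k ≤ 0 := by
    refine Finset.sum_nonpos fun k hk => mul_nonpos_of_nonpos_of_nonneg ?_ (h0 k)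
    have : (k : ℝ) ≤ j + ε := by exact_mod_cast (Finset.mem_Icc.1 hk).2
    linarith
  by_contra hc
  push Not at hc
  have := mul_pos (sub_pos.2 hc) hm
  linarith

lemma one_le_locM (n : ℤ) (p : ℤ → ℝ) (ε j : ℤ) (hε : 1 ≤ ε) (hp : IsDist n p) (hj : 0 < p j) :
    1 ≤ locM p ε j := by
  refine le_locM p ε j 1 (mass_pos p ε j hε hp.1 hj) (Finset.sum_nonneg fun k _ => ?_)
  by_cases hk : 1 ≤ k
  · have : (1 : ℝ) ≤ k := by exact_mod_cast hk
    exact mul_nonneg (by linarith) (hp.1 k)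
  · rw [hp.2.1 k (by simp; omega)]; simp

lemma locM_mono (p : ℤ → ℝ) (ε j k : ℤ) (hε : 1 ≤ ε) (h0 : ∀ m, 0 ≤ p m) (hj : 0 < p j)
    (hk : 0 < p k) (hjk : j ≤ k) : locM p ε j ≤ locM p ε k := by
  have hM := locM_le p ε j hε h0 hj
  have hc := locM_central p ε j (locM p ε j) (mass_pos p ε j hε h0 hj)
  rw [sub_self, zero_mul] at hc
  refine le_locM p ε k _ (mass_pos p ε k hε h0 hk) ?_
  generalize locM p ε j = M at *
  by_cases hcase : M < k - ε
  · refine Finset.sum_nonneg fun x hx => mul_nonneg ?_ (h0 x)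
    have : ((k:ℝ) - ε) ≤ x := by exact_mod_cast (Finset.mem_Icc.1 hx).1
    linarith
  · push Not at hcase
    rw [← hc]
    have e1 : ∑ x ∈ Finset.Icc (j - ε) (j + ε), ((x:ℝ) - M) * p x
        = ∑ x ∈ Finset.Icc (j - ε) (k + ε),
          if x ∈ Finset.Icc (j - ε) (j + ε) then ((x:ℝ) - M) * p x else 0 := by
      rw [← Finset.sum_filter]
      refine Finset.sum_congr ?_ fun _ _ => rfl
      ext x; simp; omega
    have e2 : ∑ x ∈ Finset.Icc (k - ε) (k + ε), ((x:ℝ) - M) * p x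
        = ∑ x ∈ Finset.Icc (j - ε) (k + ε),
          if x ∈ Finset.Icc (k - ε) (k + ε) then ((x:ℝ) - M) * p x else 0 := by
      rw [← Finset.sum_filter]
      refine Finset.sum_congr ?_ fun _ _ => rfl
      ext x; simp; omega
    rw [e1, e2]
    refine Finset.sum_le_sum fun x hx => ?_
    rw [Finset.mem_Icc] at hx
    simp only [Finset.mem_Icc]
    split_ifs with a b b
    · exact le_rfl
    · have : x ≤ k - ε := by omega
      have : (x:ℝ) ≤ k - ε := by exact_mod_cast this
      exact mul_nonpos_of_nonpos_of_nonneg (by linarith) (h0 x)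
    · have : j + ε ≤ x := by omega
      have : (j:ℝ) + ε ≤ x := by exact_mod_cast this
      exact mul_nonneg (by linarith) (h0 x)
    · exact le_rfl

/-- In a fixed point the net flow over every cut `{1,…,k} | {k+1,…,n}` vanishes. -/
lemma cut_flow (n ε : ℤ) (p : ℤ → ℝ)
    (hfix : ∀ k ∈ Finset.Icc (1:ℤ) n, stepHK n p ε k = p k) (k : ℤ) (hk : k ≤ n) :
    ∑ j ∈ Finset.Icc (1:ℤ) n, p j * (leftShare p ε k j - if j ≤ k then 1 else 0) = 0 := by
  have h1 : ∑ m ∈ Finset.Icc (1:ℤ) k, stepHK n p ε m = ∑ m ∈ Finset.Icc (1:ℤ) k, p m :=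
    Finset.sum_congr rfl fun m hm => hfix m (by simp at hm ⊢; omega)
  have h2 : ∑ m ∈ Finset.Icc (1:ℤ) k, stepHK n p ε m
      = ∑ j ∈ Finset.Icc (1:ℤ) n, p j * leftShare p ε k j := by
    unfold stepHK leftShare
    rw [Finset.sum_comm]
    simp_rw [Finset.mul_sum]
  have h3 : ∑ m ∈ Finset.Icc (1:ℤ) k, p m
      = ∑ j ∈ Finset.Icc (1:ℤ) n, p j * (if j ≤ k then 1 else 0) := by
    simp_rw [mul_ite, mul_one, mul_zero]
    rw [← Finset.sum_filter]
    refine Finset.sum_congr ?_ fun _ _ => rfl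
    ext x; simp; omega
  simp_rw [mul_sub]
  rw [Finset.sum_sub_distrib, ← h2, ← h3, h1, sub_self]

/-- in a fixed point of the HK interactive Markov chain, an adjacent
pair `i, i+1` of massive classes with local means strictly between `i` and `i+1`
satisfies `M_i p_i + M_{i+1} p_{i+1} = i p_i + (i+1) p_{i+1}`. -/
theorem hk_chain_fixed_pair_balance (n ε : ℤ) (hn : 1 ≤ n) (hε : 1 ≤ ε)
    (p : ℤ → ℝ) (hp : IsDist n p)
    (hfix : ∀ k ∈ Finset.Icc (1:ℤ) n, stepHK n p ε k = p k)
    (i : ℤ) (hi : i ∈ Finset.Icc (1:ℤ) (n-1)) (hpi : 0 < p i) (hpi1 : 0 < p (i+1))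
    (h1 : (i:ℝ) < locM p ε i) (h2 : locM p ε i ≤ locM p ε (i+1))
    (h3 : locM p ε (i+1) < (i:ℝ) + 1) :
    locM p ε i * p i + locM p ε (i+1) * p (i+1) = (i:ℝ) * p i + ((i:ℝ) + 1) * p (i+1) := by
  rw [Finset.mem_Icc] at hi
  have h0 := hp.1
  have hone : ∀ j, 0 < p j → 1 ≤ locM p ε j := fun j hj => one_le_locM n p ε j hε hp hj
  have hmono : ∀ j k, 0 < p j → 0 < p k → j ≤ k → locM p ε j ≤ locM p ε k :=
    fun j k hj hk hjk => locM_mono p ε j k hε h0 hj hk hjk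
  have hsupp : ∀ j, 0 < p j → j ∈ Finset.Icc (1:ℤ) n := fun j hj => by
    by_contra hc
    exact hj.ne' (hp.2.1 j hc)
  have hleft : ∀ k, k < i → 0 < p k → locM p ε k ≤ i := by
    intro k hki hk
    by_contra hc
    push Not at hc
    have hki' : (k:ℝ) + 1 ≤ i := by exact_mod_cast hki
    have hflow := cut_flow n ε p hfix k (by omega)
    have hlt : ∑ j ∈ Finset.Icc (1:ℤ) n, p j * (leftShare p ε k j - if j ≤ k then 1 else 0)
        < ∑ j ∈ Finset.Icc (1:ℤ) n, (0:ℝ) := by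
      refine Finset.sum_lt_sum (fun j _ => ?_) ⟨k, hsupp k hk, ?_⟩
      · rcases (h0 j).eq_or_lt with hj | hj
        · rw [← hj]; simp
        · split_ifs with hjk
          · have := (leftShare_bounds p ε k j (hone j hj)).2
            exact mul_nonpos_of_nonneg_of_nonpos hj.le (by linarith)
          · have := hmono k j hk hj (by omega)
            rw [leftShare_zero p ε k j (hone j hj) (by linarith)]; simp
      · rw [leftShare_zero p ε k k (hone k hk) (by linarith)]; simp [hk]
    rw [hflow] at hlt
    simp at hlt
  have hright : ∀ k, i + 1 < k → 0 < p k → (i:ℝ) + 1 ≤ locM p ε k := by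
    intro k hki hk
    by_contra hc
    push Not at hc
    have hkn := (Finset.mem_Icc.1 (hsupp k hk)).2
    have hki' : (i:ℝ) + 1 ≤ ((k - 1 : ℤ) : ℝ) := by
      have : i + 1 ≤ k - 1 := by omega
      exact_mod_cast this
    have hflow := cut_flow n ε p hfix (k - 1) (by omega)
    have hlt : ∑ j ∈ Finset.Icc (1:ℤ) n, (0:ℝ) < ∑ j ∈ Finset.Icc (1:ℤ) n,
        p j * (leftShare p ε (k - 1) j - if j ≤ k - 1 then 1 else 0) := by
      refine Finset.sum_lt_sum (fun j _ => ?_) ⟨k, hsupp k hk, ?_⟩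
      · rcases (h0 j).eq_or_lt with hj | hj
        · rw [← hj]; simp
        · split_ifs with hjk
          · have := hmono j k hj hk (by omega)
            rw [leftShare_one p ε (k - 1) j (hone j hj) (by linarith)]; simp
          · have := (leftShare_bounds p ε (k - 1) j (hone j hj)).1
            exact mul_nonneg hj.le (by linarith)
      · rw [leftShare_one p ε (k - 1) k (hone k hk) (by linarith)]; simp [hk]
    rw [hflow] at hlt
    simp at hlt
  have hflow := cut_flow n ε p hfix i (by omega)
  have hval : ∀ j ∈ Finset.Icc (1:ℤ) n, p j * (leftShare p ε i j - if j ≤ i then 1 else 0)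
      = (if j = i then p i * (i - locM p ε i) else 0)
        + (if j = i + 1 then p (i+1) * (i + 1 - locM p ε (i+1)) else 0) := by
    intro j _
    rcases lt_trichotomy j i with h | h | h
    · rw [if_pos h.le, if_neg (by omega), if_neg (by omega)]
      rcases (h0 j).eq_or_lt with hj | hj
      · rw [← hj]; simp
      · rw [leftShare_one p ε i j (hone j hj) (hleft j h hj)]; simp
    · subst h
      rw [if_pos le_rfl, if_pos rfl, if_neg (by omega),
        leftShare_mid p ε j j (hone j hpi) h1.le (by linarith)]
      ring
    · rw [if_neg (by omega : ¬ j ≤ i), if_neg (by omega : ¬ j = i)]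
      by_cases h' : j = i + 1
      · subst h'
        rw [if_pos rfl, leftShare_mid p ε i (i+1) (hone _ hpi1) (by linarith) h3]
        ring
      · rw [if_neg h']
        rcases (h0 j).eq_or_lt with hj | hj
        · rw [← hj]; simp
        · rw [leftShare_zero p ε i j (hone j hj) (hright j (by omega) hj)]; simp
  rw [Finset.sum_congr rfl hval, Finset.sum_add_distrib, Finset.sum_ite_eq', Finset.sum_ite_eq',
    if_pos (hsupp i hpi), if_pos (hsupp _ hpi1)] at hflow
  linarith
end
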